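/- With the operators Ẽ_k, F̃_k, ε_k defined for all odd integers k (by Definition 4.1 for negative indices −k with k > 0, and by the usual multisegment crystal rule for positive indices k > 0), M_θ is a crystal: for every k ∈ I, (i) F̃_k(M_θ) ⊆ M_θ and Ẽ_k(M_θ) ⊆ M_θ ⊔ {0}; (ii) F̃_k(Ẽ_k(m)) = m whenever Ẽ_k(m) ≠ 0, and Ẽ_k(F̃_k(m)) = m for all m ∈ M_θ; (iii) ε_k(m) = max{n ≥ 0 : Ẽ_k^n(m) ≠ 0} for every m ∈ M_θ. -/

import Mathlib

/-! Combinatorics of θ-restricted multisegments and their crystal operators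
(Enomoto–Kashiwara, §4.1). -/

noncomputable section
open scoped Classical

/-- Multisegments as elements of the free abelian group on the segments `⟨i,j⟩`. -/
abbrev MS : Type := (ℤ × ℤ) →₀ ℤ

/-- The segment `⟨i,j⟩` viewed as a multisegment. -/
def sg (i j : ℤ) : MS := Finsupp.single (i, j) 1

/-- `m` is a θ-restricted multisegment (`m_{i,j} = 0` unless `−j ≤ i ≤ j`, indices odd,
multiplicities nonnegative). -/
def IsTheta (m : MS) : Prop :=
  ∀ i j : ℤ, m (i, j) ≠ 0 → Odd i ∧ Odd j ∧ -j ≤ i ∧ i ≤ j ∧ 0 < m (i, j)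

/-- `A_j^{(−k)}(m)` for a positive odd integer `k`. -/
def Aneg (k : ℤ) (m : MS) (j : ℤ) : ℤ :=
  if k < j then ∑ᶠ l : ℤ, if Odd l ∧ j ≤ l then m (-k, l) - m (-k + 2, l + 2) else 0
  else if j = k then
    (∑ᶠ l : ℤ, if Odd l ∧ k < l then m (-k, l) - m (-k + 2, l) else 0)
      + 2 * m (-k, k) + (if Odd (m (-k + 2, k)) then 1 else 0)
  else
    (∑ᶠ l : ℤ, if Odd l ∧ k < l then m (-k, l) - m (-k + 2, l) else 0)
      + 2 * m (-k, k) - 2 * m (-k + 2, k - 2)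
      + (∑ᶠ i : ℤ, if Odd i ∧ -k + 2 < i ∧ i ≤ j + 2 then m (i, k) else 0)
      - (∑ᶠ i : ℤ, if Odd i ∧ -k + 2 < i ∧ i ≤ j then m (i, k - 2) else 0)

/-- `ε_{−k}(m) = max{A_j^{(−k)}(m) : j ≥ −k+2}`. -/
def epsNeg (k : ℤ) (m : MS) : ℤ :=
  sSup ((fun j => Aneg k m j) '' {j : ℤ | Odd j ∧ -k + 2 ≤ j})

/-- The rank function realizing the ordering `⋯ > k+2 > k > −k+2 > −k+4 > ⋯ > k−2`
on indices: `j` is larger in this ordering iff `rho k j` is larger in `ℤ`. -/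
def rho (k j : ℤ) : ℤ := if k ≤ j then j else -j

/-- The index `n_f`: the smallest index (in the ordering above) attaining `ε_{−k}(m)`. -/
def nfIdx (k : ℤ) (m : MS) : ℤ :=
  let r := sInf (rho k '' {j : ℤ | Odd j ∧ -k + 2 ≤ j ∧ Aneg k m j = epsNeg k m})
  if k ≤ r then r else -r

/-- The index `n_e`: the largest index (in the ordering above) attaining `ε_{−k}(m)`. -/
def neIdx (k : ℤ) (m : MS) : ℤ :=
  let r := sSup (rho k '' {j : ℤ | Odd j ∧ -k + 2 ≤ j ∧ Aneg k m j = epsNeg k m})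
  if k ≤ r then r else -r

/-- The crystal operator `F̃_{−k}` of Definition 4.1. -/
def FtilNeg (k : ℤ) (m : MS) : MS :=
  if k < nfIdx k m then m - sg (-k + 2) (nfIdx k m) + sg (-k) (nfIdx k m)
  else if nfIdx k m = k then
    (if Odd (m (-k + 2, k)) then m - sg (-k + 2) k + sg (-k) k
     else m - (if k ≠ 1 then sg (-k + 2) (k - 2) else 0) + sg (-k + 2) k)
  else m - (if nfIdx k m ≠ k - 2 then sg (nfIdx k m + 2) (k - 2) else 0) + sg (nfIdx k m + 2) k

/-- The crystal operator `Ẽ_{−k}` of Definition 4.1 (`none` stands for `0`). -/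
def EtilNeg (k : ℤ) (m : MS) : Option MS :=
  if epsNeg k m = 0 then none
  else some (if k < neIdx k m then m - sg (-k) (neIdx k m) + sg (-k + 2) (neIdx k m)
    else if neIdx k m = k then
      (if Odd (m (-k + 2, k)) then
        m - sg (-k + 2) k + (if k ≠ 1 then sg (-k + 2) (k - 2) else 0)
       else m - sg (-k) k + sg (-k + 2) k)
    else m - sg (neIdx k m + 2) k + (if neIdx k m ≠ k - 2 then sg (neIdx k m + 2) (k - 2) else 0))

/-- `n`-th iterate of `Ẽ_{−k}` (with `0 ↦ 0`). -/
def EtilNegIter (k : ℤ) (n : ℕ) (m : MS) : Option MS :=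
  (fun o => Option.bind o (EtilNeg k))^[n] (some m)

/-- `A_j^{(k)}(m)` for a positive odd integer `k` and `j ≥ k` (Definition 3.7). -/
def Apos (k : ℤ) (m : MS) (j : ℤ) : ℤ :=
  ∑ᶠ l : ℤ, if Odd l ∧ j ≤ l then m (k, l) - m (k + 2, l + 2) else 0

/-- `ε_k(m) = max{A_j^{(k)}(m) : j ≥ k}` for `k > 0`. -/
def epsPos (k : ℤ) (m : MS) : ℤ :=
  sSup ((fun j => Apos k m j) '' {j : ℤ | Odd j ∧ k ≤ j})

/-- The smallest `j ≥ k` attaining `ε_k(m)`. -/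
def jfIdx (k : ℤ) (m : MS) : ℤ := sInf {j : ℤ | Odd j ∧ k ≤ j ∧ Apos k m j = epsPos k m}

/-- The largest `j ≥ k` attaining `ε_k(m)`. -/
def jeIdx (k : ℤ) (m : MS) : ℤ := sSup {j : ℤ | Odd j ∧ k ≤ j ∧ Apos k m j = epsPos k m}

/-- The crystal operator `F̃_k` for `k > 0`. -/
def FtilPos (k : ℤ) (m : MS) : MS :=
  m - (if jfIdx k m ≠ k then sg (k + 2) (jfIdx k m) else 0) + sg k (jfIdx k m)

/-- The crystal operator `Ẽ_k` for `k > 0` (`none` stands for `0`). -/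
def EtilPos (k : ℤ) (m : MS) : Option MS :=
  if epsPos k m = 0 then none
  else some (m - sg k (jeIdx k m) + (if jeIdx k m ≠ k then sg (k + 2) (jeIdx k m) else 0))

/-- `ε_k(m)` for any odd `k`. -/
def eps (k : ℤ) (m : MS) : ℤ := if 0 < k then epsPos k m else epsNeg (-k) m

/-- The crystal operator `F̃_k` for any odd `k`. -/
def Ftil (k : ℤ) (m : MS) : MS := if 0 < k then FtilPos k m else FtilNeg (-k) m

/-- The crystal operator `Ẽ_k` for any odd `k`. -/
def Etil (k : ℤ) (m : MS) : Option MS := if 0 < k then EtilPos k m else EtilNeg (-k) m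

/-- `n`-th iterate of `Ẽ_k` (with `0 ↦ 0`). -/
def EtilIter (k : ℤ) (n : ℕ) (m : MS) : Option MS :=
  (fun o => Option.bind o (Etil k))^[n] (some m)


/-- `n` is the smallest odd index `≥ a` at which `B` attains its maximum. -/
def IsFirstMax (a : ℤ) (B : ℤ → ℤ) (n : ℤ) : Prop :=
  Odd n ∧ a ≤ n ∧ ∀ r, Odd r → a ≤ r → B r ≤ B n ∧ (r < n → B r < B n)

/-- `n` is the largest odd index `≥ a` at which `B` attains its maximum. -/
def IsLastMax (a : ℤ) (B : ℤ → ℤ) (n : ℤ) : Prop :=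
  Odd n ∧ a ≤ n ∧ ∀ r, Odd r → a ≤ r → B r ≤ B n ∧ (n < r → B r < B n)

/-- `B'` arises from `B` by adding `2` below `n` and `1` at `n`. -/
def IsRaise (a : ℤ) (B B' : ℤ → ℤ) (n : ℤ) : Prop :=
  ∀ r, Odd r → a ≤ r → B' r = B r + if r < n then 2 else if r = n then 1 else 0

section Signature

variable {a n : ℤ} {B B' : ℤ → ℤ}

theorem IsFirstMax.raise (h : IsFirstMax a B n) (hR : IsRaise a B B' n) :
    IsLastMax a B' n ∧ B' n = B n + 1 := by
  obtain ⟨ho, ha, h⟩ := h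
  have hn := hR n ho ha
  simp only [lt_irrefl, if_false, if_true] at hn
  refine ⟨⟨ho, ha, fun r hr har => ?_⟩, hn⟩
  have h1 := h r hr har
  have h2 := hR r hr har
  split_ifs at h2 <;> omega

theorem IsLastMax.lower (h : IsLastMax a B' n) (hR : IsRaise a B B' n) :
    IsFirstMax a B n ∧ B' n = B n + 1 := by
  obtain ⟨ho, ha, h⟩ := h
  have hn := hR n ho ha
  simp only [lt_irrefl, if_false, if_true] at hn
  refine ⟨⟨ho, ha, fun r hr har => ?_⟩, hn⟩
  have h1 := h r hr har
  have h2 := hR r hr har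
  split_ifs at h2 <;> omega

theorem IsFirstMax.sSup_eq (h : IsFirstMax a B n) :
    sSup (B '' {r | Odd r ∧ a ≤ r}) = B n := by
  refine IsGreatest.csSup_eq ⟨⟨n, ⟨h.1, h.2.1⟩, rfl⟩, ?_⟩
  rintro _ ⟨r, ⟨hr, har⟩, rfl⟩
  exact (h.2.2 r hr har).1

theorem IsFirstMax.sInf_eq (h : IsFirstMax a B n) :
    sInf {r | Odd r ∧ a ≤ r ∧ B r = B n} = n := by
  refine IsLeast.csInf_eq ⟨⟨h.1, h.2.1, rfl⟩, ?_⟩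
  rintro r ⟨hr, har, hB⟩
  by_contra hlt
  have := (h.2.2 r hr har).2 (by omega)
  omega

theorem IsLastMax.sSup_eq (h : IsLastMax a B n) :
    sSup {r | Odd r ∧ a ≤ r ∧ B r = B n} = n := by
  refine IsGreatest.csSup_eq ⟨⟨h.1, h.2.1, rfl⟩, ?_⟩
  rintro r ⟨hr, har, hB⟩
  by_contra hlt
  have := (h.2.2 r hr har).2 (by omega)
  omega

theorem exists_isFirstMax (h0 : ∃ N, ∀ r, N ≤ r → B r = 0) :
    ∃ n, IsFirstMax a B n ∧ 0 ≤ B n := by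
  obtain ⟨N, hN⟩ := h0
  obtain ⟨M, hMo, hMa, hMN⟩ : ∃ M, Odd M ∧ a ≤ M ∧ N ≤ M :=
    ⟨2 * max (|a|) (|N|) + 1, ⟨_, rfl⟩, by grind, by grind⟩
  have hM0 := hN M hMN
  obtain ⟨x, hx, hmax⟩ := ((Finset.Icc a M).filter Odd).exists_max_image B
    ⟨M, by simp [hMo, hMa]⟩
  have hmax' : ∀ r, Odd r → a ≤ r → B r ≤ B x := by
    intro r hr har
    by_cases hrM : r ≤ M
    · exact hmax r (by simp [hr, har, hrM])
    · rw [hN r (by omega), ← hM0]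
      exact hmax M (by simp [hMo, hMa])
  simp only [Finset.mem_filter, Finset.mem_Icc] at hx
  obtain ⟨n, hn, hmin⟩ := ((Finset.Icc a M).filter fun r => Odd r ∧ B r = B x).exists_min_image id
    ⟨x, by simp [hx]⟩
  simp only [Finset.mem_filter, Finset.mem_Icc, id] at hn hmin
  refine ⟨n, ⟨hn.2.1, hn.1.1, fun r hr har => ⟨hn.2.2 ▸ hmax' r hr har, fun hlt => ?_⟩⟩, ?_⟩
  · refine lt_of_le_of_ne (hn.2.2 ▸ hmax' r hr har) fun he => ?_
    have := hmin r ⟨⟨har, by omega⟩, hr, by omega⟩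
    omega
  · have := hmax' M hMo hMa
    omega

theorem exists_isLastMax (h0 : ∃ N, ∀ r, N ≤ r → B r = 0) (hn : IsFirstMax a B n)
    (hpos : 0 < B n) : ∃ l, IsLastMax a B l ∧ B l = B n := by
  obtain ⟨N, hN⟩ := h0
  have hbd : ∀ r, B r = B n → r ≤ N := fun r hr => by
    by_contra hlt
    have := hN r (by omega)
    omega
  obtain ⟨l, hl, hmax⟩ := ((Finset.Icc a N).filter fun r => Odd r ∧ B r = B n).exists_max_image id
    ⟨n, by simp [hn.1, hn.2.1, hbd n rfl]⟩
  simp only [Finset.mem_filter, Finset.mem_Icc, id] at hl hmax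
  refine ⟨l, ⟨hl.2.1, hl.1.1, fun r hr har => ⟨hl.2.2 ▸ (hn.2.2 r hr har).1, fun hlt => ?_⟩⟩,
    hl.2.2⟩
  refine lt_of_le_of_ne (hl.2.2 ▸ (hn.2.2 r hr har).1) fun he => ?_
  have := hmax r ⟨⟨har, hbd r (by omega)⟩, hr, by omega⟩
  omega

/-- The signature rule: operators which raise and lower a family of functions at the first and
last maximum satisfy the crystal axioms. -/
theorem crystal_of_signature {M : Type*} {P : M → Prop} {B : M → ℤ → ℤ} {up down : M → ℤ → M}
    {F : M → M} {E : M → Option M} {e : M → ℤ} (a : ℤ)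
    (h0 : ∀ m, ∃ N, ∀ r, N ≤ r → B m r = 0)
    (hup : ∀ m n, P m → IsFirstMax a (B m) n →
      P (up m n) ∧ IsRaise a (B m) (B (up m n)) n ∧ down (up m n) n = m)
    (hdown : ∀ m n, P m → IsLastMax a (B m) n →
      P (down m n) ∧ IsRaise a (B (down m n)) (B m) n ∧ up (down m n) n = m)
    (he : ∀ m n, IsFirstMax a (B m) n → e m = B m n)
    (hF : ∀ m n, IsFirstMax a (B m) n → F m = up m n)
    (hE0 : ∀ m, e m = 0 → E m = none)
    (hE : ∀ m n, IsLastMax a (B m) n → e m = B m n → e m ≠ 0 → E m = some (down m n)) :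
    (∀ m, P m → P (F m)) ∧
    (∀ m m', P m → E m = some m' → P m') ∧
    (∀ m m', P m → E m = some m' → F m' = m) ∧
    (∀ m, P m → E (F m) = some m) ∧
    (∀ m, P m → 0 ≤ e m ∧
      IsGreatest {i : ℕ | (fun o => Option.bind o E)^[i] (some m) ≠ none} (e m).toNat) := by
  have hnn : ∀ m, 0 ≤ e m := fun m => by
    obtain ⟨n, hn, hn0⟩ := exists_isFirstMax (a := a) (h0 m)
    rwa [he m n hn]
  have hlow : ∀ m, P m → e m ≠ 0 →
      ∃ m', E m = some m' ∧ P m' ∧ F m' = m ∧ e m = e m' + 1 := by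
    intro m hm hne
    obtain ⟨n, hn, -⟩ := exists_isFirstMax (a := a) (h0 m)
    have hen := he m n hn
    have := hnn m
    obtain ⟨l, hl, hln⟩ := exists_isLastMax (h0 m) hn (by omega)
    obtain ⟨h1, h2, h3⟩ := hdown m l hm hl
    obtain ⟨h4, h5⟩ := hl.lower h2
    refine ⟨_, hE m l hl (by omega) hne, h1, by rw [hF _ l h4, h3], ?_⟩
    rw [he _ l h4]
    omega
  refine ⟨fun m hm => ?_, fun m m' hm h => ?_, fun m m' hm h => ?_, fun m hm => ?_,
    fun m hm => ⟨hnn m, ?_⟩⟩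
  · obtain ⟨n, hn, -⟩ := exists_isFirstMax (a := a) (h0 m)
    rw [hF m n hn]
    exact (hup m n hm hn).1
  · have hne : e m ≠ 0 := fun h' => by simp [hE0 m h'] at h
    obtain ⟨x, hx, hPx, -⟩ := hlow m hm hne
    rw [h] at hx
    cases hx
    exact hPx
  · have hne : e m ≠ 0 := fun h' => by simp [hE0 m h'] at h
    obtain ⟨x, hx, -, hFx, -⟩ := hlow m hm hne
    rw [h] at hx
    cases hx
    exact hFx
  · obtain ⟨n, hn, hn0⟩ := exists_isFirstMax (a := a) (h0 m)
    obtain ⟨h1, h2, h3⟩ := hup m n hm hn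
    obtain ⟨h4, h5⟩ := hn.raise h2
    obtain ⟨f, hf, -⟩ := exists_isFirstMax (a := a) (h0 (up m n))
    have hef := he _ f hf
    have : B (up m n) f = B (up m n) n :=
      le_antisymm (h4.2.2 f hf.1 hf.2.1).1 (hf.2.2 n h4.1 h4.2.1).1
    rw [hF m n hn, hE _ n h4 (by omega) (by omega), h3]
  · have key : ∀ (i : ℕ) (m : M), P m →
        ((fun o => Option.bind o E)^[i] (some m) ≠ none ↔ (i : ℤ) ≤ e m) := by
      intro i
      induction i with
      | zero => intro m _; simpa using hnn m
      | succ i ih =>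
        intro m hm
        rw [Function.iterate_succ_apply, Option.bind_some]
        by_cases hne : e m = 0
        · rw [hE0 m hne, Function.iterate_fixed (by rfl)]
          simp only [ne_eq, not_true_eq_false, false_iff]
          omega
        · obtain ⟨m', hm', hP, -, h⟩ := hlow m hm hne
          rw [hm', ih m' hP]
          omega
    have := hnn m
    refine ⟨(key _ m hm).2 (by omega), fun i hi => ?_⟩
    have := (key i m hm).1 hi
    omega

end Signature

section Theta

theorem isTheta_iff {m : MS} : IsTheta m ↔ ∀ i j : ℤ, 0 ≤ m (i, j) ∧
    (0 < m (i, j) → Odd i ∧ Odd j ∧ -j ≤ i ∧ i ≤ j) := by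
  refine forall₂_congr fun i j => ⟨fun h => ?_, fun h hne => ?_⟩
  · by_cases h0 : m (i, j) = 0
    · simp [h0]
    · have := h h0
      exact ⟨this.2.2.2.2.le, fun _ => ⟨this.1, this.2.1, this.2.2.1, this.2.2.2.1⟩⟩
  · have hpos : 0 < m (i, j) := lt_of_le_of_ne h.1 (Ne.symm hne)
    have := h.2 hpos
    exact ⟨this.1, this.2.1, this.2.2.1, this.2.2.2, hpos⟩

theorem IsTheta.nonneg {m : MS} (h : IsTheta m) (p : ℤ × ℤ) : 0 ≤ m p :=
  (isTheta_iff.1 h p.1 p.2).1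

theorem IsTheta.add_sg {m : MS} (h : IsTheta m) {i j : ℤ} (hi : Odd i) (hj : Odd j)
    (hij : -j ≤ i) (hij' : i ≤ j) : IsTheta (m + sg i j) := by
  rw [isTheta_iff] at *
  intro a b
  have := h a b
  by_cases hab : (i, j) = (a, b)
  · cases hab
    simp only [sg, Finsupp.add_apply, Finsupp.single_eq_same]
    exact ⟨by omega, fun _ => ⟨hi, hj, hij, hij'⟩⟩
  · simpa [sg, Finsupp.single_apply, hab] using this

theorem IsTheta.sub_sg {m : MS} (h : IsTheta m) {i j : ℤ} (hpos : 0 < m (i, j)) :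
    IsTheta (m - sg i j) := by
  rw [isTheta_iff] at *
  intro a b
  have := h a b
  by_cases hab : (i, j) = (a, b)
  · cases hab
    simp only [sg, Finsupp.sub_apply, Finsupp.single_eq_same]
    exact ⟨by omega, fun _ => this.2 hpos⟩
  · simpa [sg, Finsupp.single_apply, hab] using this

end Theta

section Weights

theorem finite_support_ite (g : ℤ → ℤ × ℤ) (hg : Function.Injective g) (Q : ℤ → Prop)
    [DecidablePred Q] (m : MS) :
    (Function.support fun l => if Q l then m (g l) else 0).Finite := by
  refine (m.support.finite_toSet.preimage hg.injOn).subset fun l hl => ?_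
  simp only [Function.mem_support, ne_eq, ite_eq_right_iff, Classical.not_imp] at hl
  simpa using hl.2

/-- A `finsum` of multiplicities as a linear functional. -/
theorem finsum_eq_linearCombination (g : ℤ → ℤ × ℤ) (hg : Function.Injective g) (Q : ℤ → Prop) [DecidablePred Q]
    (c : ℤ × ℤ → ℤ) (hc1 : ∀ l, Q l → c (g l) = 1) (hc0 : ∀ p, (∀ l, g l = p → ¬ Q l) → c p = 0)
    (m : MS) : (∑ᶠ l, if Q l then m (g l) else 0) = Finsupp.linearCombination ℤ c m := by
  induction m using Finsupp.induction_linear with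
  | zero => simp
  | add x y hx hy =>
    rw [map_add, ← hx, ← hy, ← finsum_add_distrib (finite_support_ite g hg Q x)
      (finite_support_ite g hg Q y)]
    refine finsum_congr fun l => ?_
    split_ifs <;> simp
  | single p b =>
    rw [Finsupp.linearCombination_single, smul_eq_mul]
    by_cases hp : ∃ l, g l = p ∧ Q l
    · obtain ⟨l, rfl, hl⟩ := hp
      rw [finsum_eq_single _ l fun l' hl' => by simp [hg.eq_iff, hl'.symm]]
      simp [hl, hc1]
    · rw [hc0 p fun l h1 h2 => hp ⟨l, h1, h2⟩, mul_zero]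
      refine finsum_eq_zero_of_forall_eq_zero fun l => ?_
      split_ifs with hl
      · exact Finsupp.single_eq_of_ne fun h => hp ⟨l, h, hl⟩
      · rfl

/-- The coefficient of `m p` in `Apos k m j`. -/
def wPos (k j : ℤ) (p : ℤ × ℤ) : ℤ :=
  (if p.1 = k ∧ Odd p.2 ∧ j ≤ p.2 then 1 else 0) -
    (if p.1 = k + 2 ∧ Odd p.2 ∧ j + 2 ≤ p.2 then 1 else 0)

/-- The coefficient of `m p` in the terms shared by all `Aneg k m j` with `j ≤ k`. -/
def wBase (k : ℤ) (p : ℤ × ℤ) : ℤ :=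
  (if p.1 = -k ∧ Odd p.2 ∧ k < p.2 then 1 else 0) -
    (if p.1 = -k + 2 ∧ Odd p.2 ∧ k < p.2 then 1 else 0) + (if p = (-k, k) then 2 else 0)

/-- The coefficient of `m p` in `Aneg k m j`, up to the parity term. -/
def wNeg (k j : ℤ) (p : ℤ × ℤ) : ℤ :=
  if k < j then wPos (-k) j p
  else if j = k then wBase k p
  else wBase k p - (if p = (-k + 2, k - 2) then 2 else 0) +
    (if p.2 = k ∧ Odd p.1 ∧ -k + 2 < p.1 ∧ p.1 ≤ j + 2 then 1 else 0) -
    (if p.2 = k - 2 ∧ Odd p.1 ∧ -k + 2 < p.1 ∧ p.1 ≤ j then 1 else 0)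

theorem linearCombination_sub_coeff (c d : ℤ × ℤ → ℤ) (m : MS) :
    Finsupp.linearCombination ℤ (fun p => c p - d p) m =
      Finsupp.linearCombination ℤ c m - Finsupp.linearCombination ℤ d m := by
  simp [Finsupp.linearCombination_apply, Finsupp.sum, mul_sub]

theorem linearCombination_add_coeff (c d : ℤ × ℤ → ℤ) (m : MS) :
    Finsupp.linearCombination ℤ (fun p => c p + d p) m =
      Finsupp.linearCombination ℤ c m + Finsupp.linearCombination ℤ d m := by
  simp [Finsupp.linearCombination_apply, Finsupp.sum, mul_add, Finset.sum_add_distrib]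

theorem linearCombination_ite_eq (q : ℤ × ℤ) (b : ℤ) (m : MS) :
    Finsupp.linearCombination ℤ (fun p => if p = q then b else 0) m = b * m q := by
  rw [Finsupp.linearCombination_apply, Finsupp.sum]
  simp [mul_comm]
  intro h; simp [h]

theorem linearCombination_sg (c : ℤ × ℤ → ℤ) (i j : ℤ) :
    Finsupp.linearCombination ℤ c (sg i j) = c (i, j) := by
  simp [sg]

theorem finsum_row (i : ℤ) (Q : ℤ → Prop)
    [DecidablePred Q] (m : MS) : (∑ᶠ l, if Q l then m (i, l) else 0) =
    Finsupp.linearCombination ℤ (fun p => if p.1 = i ∧ Q p.2 then 1 else 0) m := by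
  refine finsum_eq_linearCombination (fun l => (i, l)) (Prod.mk_right_injective i) Q _
    (fun l hl => by simp [hl]) (fun p hp => if_neg fun h => hp p.2 ?_ h.2) m
  ext <;> simp [h.1]

theorem finsum_col (j : ℤ) (Q : ℤ → Prop)
    [DecidablePred Q] (m : MS) : (∑ᶠ l, if Q l then m (l, j) else 0) =
    Finsupp.linearCombination ℤ (fun p => if p.2 = j ∧ Q p.1 then 1 else 0) m := by
  refine finsum_eq_linearCombination (fun l => (l, j)) (Prod.mk_left_injective j) Q _
    (fun l hl => by simp [hl]) (fun p hp => if_neg fun h => hp p.1 ?_ h.2) m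
  ext <;> simp [h.1]

theorem Apos_eq (k j : ℤ) (m : MS) : Apos k m j = Finsupp.linearCombination ℤ (wPos k j) m := by
  have hinj : Function.Injective fun l : ℤ => (k + 2, l + 2) := fun a b h => by simpa using h
  unfold wPos
  rw [linearCombination_sub_coeff, ← finsum_row k (fun l => Odd l ∧ j ≤ l),
    ← finsum_eq_linearCombination (fun l => (k + 2, l + 2)) hinj (fun l => Odd l ∧ j ≤ l),
    ← finsum_sub_distrib (finite_support_ite (fun l => (k, l)) (Prod.mk_right_injective k) _ _)
      (finite_support_ite (fun l => (k + 2, l + 2)) hinj _ _)]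
  · refine finsum_congr fun l => ?_
    split_ifs <;> simp
  · rintro l ⟨hl, hj⟩
    simp [hl.add_even (by decide : Even (2 : ℤ)), hj]
  · intro p hp
    refine if_neg fun h => hp (p.2 - 2) ?_ ⟨h.2.1.sub_even (by decide), by omega⟩
    ext <;> simp [h.1]

theorem linearCombination_wBase (k : ℤ) (m : MS) :
    (∑ᶠ l : ℤ, if Odd l ∧ k < l then m (-k, l) - m (-k + 2, l) else 0) + 2 * m (-k, k) =
      Finsupp.linearCombination ℤ (wBase k) m := by
  unfold wBase
  rw [linearCombination_add_coeff, linearCombination_sub_coeff, linearCombination_ite_eq,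
    ← finsum_row (-k) (fun l => Odd l ∧ k < l), ← finsum_row (-k + 2) (fun l => Odd l ∧ k < l),
    ← finsum_sub_distrib (finite_support_ite (fun l => (-k, l)) (Prod.mk_right_injective _) _ _)
      (finite_support_ite (fun l => (-k + 2, l)) (Prod.mk_right_injective _) _ _)]
  congr 1
  refine finsum_congr fun l => ?_
  split_ifs <;> simp

theorem Aneg_eq (k j : ℤ) (m : MS) : Aneg k m j = Finsupp.linearCombination ℤ (wNeg k j) m +
    if j = k then (if Odd (m (-k + 2, k)) then 1 else 0) else 0 := by
  by_cases h1 : k < j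
  · have : wNeg k j = wPos (-k) j := by ext p; simp [wNeg, h1]
    rw [this, ← Apos_eq]
    simp [Aneg, Apos, h1, h1.ne']
  by_cases h2 : j = k
  · have : wNeg k j = wBase k := by ext p; simp [wNeg, h2]
    rw [this, ← linearCombination_wBase]
    simp [Aneg, h2]
  · have : wNeg k j = fun p => wBase k p - (if p = (-k + 2, k - 2) then 2 else 0) +
        (if p.2 = k ∧ Odd p.1 ∧ -k + 2 < p.1 ∧ p.1 ≤ j + 2 then 1 else 0) -
        (if p.2 = k - 2 ∧ Odd p.1 ∧ -k + 2 < p.1 ∧ p.1 ≤ j then 1 else 0) := by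
      ext p; simp [wNeg, h1, h2]
    rw [this, linearCombination_sub_coeff, linearCombination_add_coeff,
      linearCombination_sub_coeff, linearCombination_ite_eq, ← linearCombination_wBase,
      ← finsum_col k (fun i => Odd i ∧ -k + 2 < i ∧ i ≤ j + 2),
      ← finsum_col (k - 2) (fun i => Odd i ∧ -k + 2 < i ∧ i ≤ j)]
    simp [Aneg, h1, h2]

theorem Apos_eventually_zero (k : ℤ) (m : MS) : ∃ N, ∀ j, N ≤ j → Apos k m j = 0 := by
  obtain ⟨N, hN⟩ := (m.support.image Prod.snd).bddAbove
  refine ⟨N + 1, fun j hj => ?_⟩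
  rw [Apos_eq, Finsupp.linearCombination_apply]
  refine Finset.sum_eq_zero fun p hp => ?_
  have : p.2 ≤ N := hN (by simpa using ⟨p.1, by simpa using hp⟩)
  have hw : wPos k j p = 0 := by
    rw [wPos, if_neg (by omega), if_neg (by omega), sub_zero]
  simp [hw]

/-- Consecutive values of `Apos`. -/
theorem Apos_succ {k j : ℤ} (hj : Odd j) (m : MS) :
    Apos k m j = Apos k m (j + 2) + m (k, j) - m (k + 2, j + 2) := by
  have : wPos k j = fun p => wPos k (j + 2) p + (if p = (k, j) then 1 else 0) -
      (if p = (k + 2, j + 2) then 1 else 0) := by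
    ext ⟨a, b⟩
    simp only [wPos, Prod.mk.injEq, Int.odd_iff] at *
    split_ifs <;> omega
  rw [Apos_eq, Apos_eq, this, linearCombination_sub_coeff, linearCombination_add_coeff,
    linearCombination_ite_eq, linearCombination_ite_eq]
  ring

end Weights

section Positive

variable {k n : ℤ} {m : MS}

theorem isRaise_Apos (hn : Odd n) :
    IsRaise k (Apos k m)
      (Apos k (m - (if n ≠ k then sg (k + 2) n else 0) + sg k n)) n := by
  intro r hr hkr
  have h : Apos k (if n ≠ k then sg (k + 2) n else 0) r =
      if n ≠ k then wPos k r (k + 2, n) else 0 := by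
    split_ifs <;> simp [Apos_eq, linearCombination_sg]
  rw [Apos_eq] at h
  rw [Apos_eq, Apos_eq, map_add, map_sub, linearCombination_sg, h]
  clear h
  simp only [wPos, Int.odd_iff, true_and] at *
  split_ifs <;> omega

theorem crystal_pos (hk : Odd k) (hk0 : 0 < k) :
    (∀ m, IsTheta m → IsTheta (FtilPos k m)) ∧
    (∀ m m', IsTheta m → EtilPos k m = some m' → IsTheta m') ∧
    (∀ m m', IsTheta m → EtilPos k m = some m' → FtilPos k m' = m) ∧
    (∀ m, IsTheta m → EtilPos k (FtilPos k m) = some m) ∧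
    (∀ m, IsTheta m → 0 ≤ epsPos k m ∧
      IsGreatest {i : ℕ | (fun o => Option.bind o (EtilPos k))^[i] (some m) ≠ none}
        (epsPos k m).toNat) := by
  refine crystal_of_signature (B := Apos k)
    (up := fun m n => m - (if n ≠ k then sg (k + 2) n else 0) + sg k n)
    (down := fun m n => m - sg k n + (if n ≠ k then sg (k + 2) n else 0)) k
    (Apos_eventually_zero k) (fun m n hm hn => ⟨?_, isRaise_Apos hn.1, by abel⟩)
    (fun m n hm hn => ⟨?_, ?_, by abel⟩) (fun m n hn => hn.sSup_eq) (fun m n hn => ?_)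
    (fun m hm => if_pos hm) (fun m n hn he hne => ?_)
  · obtain ⟨ho, hkn, hmax⟩ := hn
    refine IsTheta.add_sg ?_ hk ho (by omega) hkn
    split_ifs with h
    · refine hm.sub_sg ?_
      have hn' : Odd (n - 2) := ho.sub_even (by decide)
      have h1 := (hmax (n - 2) hn' (by rw [Int.odd_iff] at *; omega)).2 (by omega)
      have h2 := Apos_succ (k := k) hn' m
      have h3 := hm.nonneg (k, n - 2)
      simp only [sub_add_cancel] at h2
      omega
    · simpa using hm
  · obtain ⟨ho, hkn, hmax⟩ := hn
    have hpos : 0 < m (k, n) := by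
      have h1 := (hmax (n + 2) (ho.add_even (by decide)) (by omega)).2 (by omega)
      have h2 := Apos_succ (k := k) ho m
      have h3 := hm.nonneg (k + 2, n + 2)
      omega
    split_ifs with h
    · refine (hm.sub_sg hpos).add_sg (hk.add_even (by decide)) ho (by omega) ?_
      rw [Int.odd_iff] at *
      omega
    · simpa using hm.sub_sg hpos
  · have := isRaise_Apos (k := k)
      (m := m - sg k n + (if n ≠ k then sg (k + 2) n else 0)) hn.1
    rwa [add_sub_cancel_right, sub_add_cancel] at this
  · have : jfIdx k m = n := by
      rw [jfIdx, epsPos, hn.sSup_eq, hn.sInf_eq]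
    simp only [FtilPos, this]
  · have : jeIdx k m = n := by
      rw [jeIdx, he, hn.sSup_eq]
    rw [EtilPos, if_neg hne, this]

end Positive

section Negative

/-- `FtilNeg` acting at a prescribed index `j`. -/
def upNeg (k : ℤ) (m : MS) (j : ℤ) : MS :=
  if k < j then m - sg (-k + 2) j + sg (-k) j
  else if j = k then
    (if Odd (m (-k + 2, k)) then m - sg (-k + 2) k + sg (-k) k
     else m - (if k ≠ 1 then sg (-k + 2) (k - 2) else 0) + sg (-k + 2) k)
  else m - (if j ≠ k - 2 then sg (j + 2) (k - 2) else 0) + sg (j + 2) k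

/-- `EtilNeg` acting at a prescribed index `j`. -/
def downNeg (k : ℤ) (m : MS) (j : ℤ) : MS :=
  if k < j then m - sg (-k) j + sg (-k + 2) j
  else if j = k then
    (if Odd (m (-k + 2, k)) then
      m - sg (-k + 2) k + (if k ≠ 1 then sg (-k + 2) (k - 2) else 0)
     else m - sg (-k) k + sg (-k + 2) k)
  else m - sg (j + 2) k + (if j ≠ k - 2 then sg (j + 2) (k - 2) else 0)

variable {k n r j : ℤ} {m : MS}

theorem sg_apply (i j a b : ℤ) : sg i j (a, b) = if i = a ∧ j = b then 1 else 0 := by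
  simp [sg, Finsupp.single_apply]

theorem rho_of_le (h : k ≤ r) : rho k r = r := if_pos h

theorem rho_of_lt (h : r < k) : rho k r = -r := if_neg h.not_ge

/-- Membership of `r` in the set of ranks `r ≥ -k + 2`. -/
theorem rho_cases (har : -k + 2 ≤ r) :
    k < r ∧ rho k r = r ∨ r = k ∧ rho k r = k ∨
      r < k ∧ rho k r = -r ∧ -r < k ∧ -k < r := by
  rcases lt_trichotomy k r with h | h | h
  · exact .inl ⟨h, rho_of_le h.le⟩
  · exact .inr (.inl ⟨h.symm, h ▸ rho_of_le le_rfl⟩)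
  · exact .inr (.inr ⟨h, rho_of_lt h, by omega, by omega⟩)

theorem wNeg_row (hk : Odd k) (hr : Odd r) (har : -k + 2 ≤ r) (hn : Odd n)
    (hkn : k < n) : wNeg k (rho k r) (-k, n) = if r ≤ n then 1 else 0 := by
  rcases rho_cases har with ⟨h, e⟩ | ⟨h, e⟩ | ⟨h, e, h', h''⟩ <;>
    simp only [e, wNeg, wBase, wPos, Int.odd_iff, Prod.mk.injEq, true_and] at * <;>
    split_ifs <;> omega

theorem wNeg_row_succ (hk : Odd k) (hr : Odd r) (har : -k + 2 ≤ r) (hn : Odd n)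
    (hkn : k < n) : wNeg k (rho k r) (-k + 2, n) = if r < n then -1 else 0 := by
  rcases rho_cases har with ⟨h, e⟩ | ⟨h, e⟩ | ⟨h, e, h', h''⟩ <;>
    simp only [e, wNeg, wBase, wPos, Int.odd_iff, Prod.mk.injEq, true_and] at * <;>
    split_ifs <;> omega

theorem wNeg_row_self (hk : Odd k) (har : -k + 2 ≤ r) :
    wNeg k (rho k r) (-k, k) = if r ≤ k then 2 else 0 := by
  rcases rho_cases har with ⟨h, e⟩ | ⟨h, e⟩ | ⟨h, e, h', h''⟩ <;>
    simp only [e, wNeg, wBase, wPos, Int.odd_iff, Prod.mk.injEq, true_and] at * <;>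
    split_ifs <;> omega

theorem wNeg_row_succ_self (har : -k + 2 ≤ r) :
    wNeg k (rho k r) (-k + 2, k) = 0 := by
  rcases rho_cases har with ⟨h, e⟩ | ⟨h, e⟩ | ⟨h, e, h', h''⟩ <;>
    simp only [e, wNeg, wBase, wPos, Int.odd_iff, Prod.mk.injEq, true_and] at * <;>
    split_ifs <;> omega

theorem wNeg_corner (har : -k + 2 ≤ r) :
    wNeg k (rho k r) (-k + 2, k - 2) = if r < k then -2 else 0 := by
  rcases rho_cases har with ⟨h, e⟩ | ⟨h, e⟩ | ⟨h, e, h', h''⟩ <;>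
    simp only [e, wNeg, wBase, wPos, Int.odd_iff, Prod.mk.injEq, true_and] at * <;>
    split_ifs <;> omega

theorem wNeg_col (har : -k + 2 ≤ r) (hn : Odd n) (hnk : n < k) :
    wNeg k (rho k r) (-n + 2, k) = if r ≤ n then 1 else 0 := by
  rcases rho_cases har with ⟨h, e⟩ | ⟨h, e⟩ | ⟨h, e, h', h''⟩ <;>
    simp only [e, wNeg, wBase, wPos, Int.odd_iff, Prod.mk.injEq, true_and] at * <;>
    split_ifs <;> omega

theorem wNeg_col_pred (hr : Odd r) (har : -k + 2 ≤ r) (hn : Odd n) (hnk : n < k) :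
    wNeg k (rho k r) (-n + 2, k - 2) = if r < n then -1 else 0 := by
  rcases rho_cases har with ⟨h, e⟩ | ⟨h, e⟩ | ⟨h, e, h', h''⟩ <;>
    simp only [e, wNeg, wBase, wPos, Int.odd_iff, Prod.mk.injEq, true_and] at * <;>
    split_ifs <;> omega

theorem Aneg_eq_Apos (h : k < j) : Aneg k m j = Apos (-k) m j := by
  simp [Aneg, Apos, h]

theorem Aneg_row_succ (hj : Odd j) (h : k < j) :
    Aneg k m j = Aneg k m (j + 2) + m (-k, j) - m (-k + 2, j + 2) := by
  rw [Aneg_eq_Apos h, Aneg_eq_Apos (by omega), Apos_succ hj]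

theorem Aneg_self (hk : Odd k) :
    Aneg k m k = Aneg k m (k + 2) + 2 * m (-k, k) - m (-k + 2, k + 2) +
      if Odd (m (-k + 2, k)) then 1 else 0 := by
  have : wNeg k k = fun p => wNeg k (k + 2) p + (if p = (-k, k) then 2 else 0) -
      (if p = (-k + 2, k + 2) then 1 else 0) := by
    ext ⟨a, b⟩
    simp only [wNeg, wBase, wPos, Prod.mk.injEq, Int.odd_iff] at *
    split_ifs <;> omega
  rw [Aneg_eq, Aneg_eq, this, linearCombination_sub_coeff, linearCombination_add_coeff,
    linearCombination_ite_eq, linearCombination_ite_eq, if_pos rfl,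
    if_neg (show ¬ k + 2 = k by omega)]
  ring

theorem Aneg_corner (hk : Odd k) (h : -k + 2 < k) :
    Aneg k m (-k + 2) + (if Odd (m (-k + 2, k)) then 1 else 0) =
      Aneg k m k - 2 * m (-k + 2, k - 2) + m (-k + 4, k) := by
  have : wNeg k (-k + 2) = fun p => wNeg k k p - (if p = (-k + 2, k - 2) then 2 else 0) +
      (if p = (-k + 4, k) then 1 else 0) := by
    ext ⟨a, b⟩
    simp only [wNeg, if_neg h.not_gt, if_neg h.ne, if_neg (lt_irrefl k), if_true, Prod.mk.injEq,
      Int.odd_iff] at *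
    split_ifs <;> omega
  rw [Aneg_eq, Aneg_eq, this, linearCombination_add_coeff, linearCombination_sub_coeff,
    linearCombination_ite_eq, linearCombination_ite_eq, if_neg h.ne, if_pos rfl]
  ring

theorem Aneg_col_succ (hj : Odd j) (hkj : -k + 2 ≤ j) (h : j + 2 < k) :
    Aneg k m (j + 2) = Aneg k m j + m (j + 4, k) - m (j + 2, k - 2) := by
  have hj1 : ¬ j + 2 = k := h.ne
  have hj2 : ¬ j = k := by omega
  have : wNeg k (j + 2) = fun p => wNeg k j p + (if p = (j + 4, k) then 1 else 0) -
      (if p = (j + 2, k - 2) then 1 else 0) := by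
    ext ⟨a, b⟩
    simp only [wNeg, if_neg hj1, if_neg hj2, if_neg h.not_gt, if_neg (show ¬ k < j by omega),
      Prod.mk.injEq, Int.odd_iff] at *
    split_ifs <;> omega
  rw [Aneg_eq, Aneg_eq, this, linearCombination_sub_coeff, linearCombination_add_coeff,
    linearCombination_ite_eq, linearCombination_ite_eq, if_neg hj1, if_neg hj2]
  ring

theorem odd_sub_one_iff (x : ℤ) : Odd (x - 1) ↔ ¬ Odd x := by
  simp only [Int.odd_iff]; omega

theorem odd_add_one_iff (x : ℤ) : Odd (x + 1) ↔ ¬ Odd x := by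
  simp only [Int.odd_iff]; omega

/-- Multiplicity of `⟨-k+2, k⟩`, which governs the parity term, after `upNeg`. -/
theorem upNeg_apply (hj : -k + 2 ≤ j) : upNeg k m j (-k + 2, k) =
    m (-k + 2, k) + if j = k then (if Odd (m (-k + 2, k)) then -1 else 1) else 0 := by
  unfold upNeg
  split_ifs <;> simp only [Finsupp.add_apply, Finsupp.sub_apply, Finsupp.zero_apply, sg_apply,
    true_and] <;> split_ifs <;> omega

theorem downNeg_apply (hj : -k + 2 ≤ j) : downNeg k m j (-k + 2, k) =
    m (-k + 2, k) + if j = k then (if Odd (m (-k + 2, k)) then -1 else 1) else 0 := by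
  unfold downNeg
  split_ifs <;> simp only [Finsupp.add_apply, Finsupp.sub_apply, Finsupp.zero_apply, sg_apply,
    true_and] <;> split_ifs <;> omega

theorem downNeg_upNeg (hj : -k + 2 ≤ j) : downNeg k (upNeg k m j) j = m := by
  rw [downNeg, upNeg_apply hj, upNeg]
  by_cases h1 : k < j
  · simp only [if_pos h1]; abel
  by_cases h2 : j = k
  · by_cases h3 : Odd (m (-k + 2, k))
    · have : ¬ Odd (m (-k + 2, k) + -1) := fun h => (odd_sub_one_iff _).1 h h3
      simp only [if_neg h1, if_pos h2, if_pos h3, if_neg this]; abel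
    · have := (odd_add_one_iff _).2 h3
      simp only [if_neg h1, if_pos h2, if_neg h3, if_pos this]; abel
  · simp only [if_neg h1, if_neg h2]; abel

theorem upNeg_downNeg (hj : -k + 2 ≤ j) : upNeg k (downNeg k m j) j = m := by
  rw [upNeg, downNeg_apply hj, downNeg]
  by_cases h1 : k < j
  · simp only [if_pos h1]; abel
  by_cases h2 : j = k
  · by_cases h3 : Odd (m (-k + 2, k))
    · have : ¬ Odd (m (-k + 2, k) + -1) := fun h => (odd_sub_one_iff _).1 h h3
      simp only [if_neg h1, if_pos h2, if_pos h3, if_neg this]; abel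
    · have := (odd_add_one_iff _).2 h3
      simp only [if_neg h1, if_pos h2, if_neg h3, if_pos this]; abel
  · simp only [if_neg h1, if_neg h2]; abel

theorem rho_mem (hk : Odd k) (hk0 : 0 < k) (hr : Odd r) (har : -k + 2 ≤ r) :
    Odd (rho k r) ∧ -k + 2 ≤ rho k r ∧ rho k (rho k r) = r := by
  rcases rho_cases har with ⟨h, e⟩ | ⟨h, e⟩ | ⟨h, e, h', h''⟩
  · exact ⟨by rwa [e], by omega, by rw [e, e]⟩
  · exact ⟨by rwa [e], by omega, by rw [e, rho_of_le le_rfl, h]⟩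
  · refine ⟨by rw [e]; exact hr.neg, ?_, by rw [e, rho_of_lt h', neg_neg]⟩
    rw [Int.odd_iff] at *
    omega

theorem isRaise_Aneg (hk : Odd k) (hk0 : 0 < k) (hn : Odd n) (han : -k + 2 ≤ n) :
    IsRaise (-k + 2) (fun r => Aneg k m (rho k r))
      (fun r => Aneg k (upNeg k m (rho k n)) (rho k r)) n := by
  intro r hr har
  have hrk : rho k r = k ↔ r = k := by
    rcases rho_cases har with ⟨h, e⟩ | ⟨h, e⟩ | ⟨h, e, h', h''⟩ <;> omega
  simp only [Aneg_eq, hrk]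
  have hj := (rho_mem hk hk0 hn han).2.1
  rw [upNeg_apply hj]
  rcases rho_cases han with ⟨h, e⟩ | ⟨h, e⟩ | ⟨h, e, h', h''⟩
  · rw [e, if_neg h.ne', upNeg, if_pos h, map_add, map_sub, linearCombination_sg,
      linearCombination_sg, wNeg_row hk hr har hn h, wNeg_row_succ hk hr har hn h,
      add_zero]
    split_ifs <;> omega
  · rw [e, if_pos rfl, upNeg, if_neg (lt_irrefl k), if_pos rfl]
    by_cases hodd : Odd (m (-k + 2, k))
    · have : ¬ Odd (m (-k + 2, k) + -1) := fun h => (odd_sub_one_iff _).1 h hodd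
      rw [if_pos hodd, if_pos hodd, if_pos hodd, if_neg this, map_add, map_sub,
        linearCombination_sg, linearCombination_sg, wNeg_row_self hk har,
        wNeg_row_succ_self har]
      split_ifs <;> omega
    · have := (odd_add_one_iff _).2 hodd
      have hc : Finsupp.linearCombination ℤ (wNeg k (rho k r))
          (if k ≠ 1 then sg (-k + 2) (k - 2) else 0) = if r < k then -2 else 0 := by
        split_ifs with h1 h2 h2
        · rw [linearCombination_sg, wNeg_corner har, if_pos h2]
        · rw [linearCombination_sg, wNeg_corner har, if_neg h2]
        · rw [Int.odd_iff] at hr; omega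
        · simp
      rw [if_neg hodd, if_neg hodd, if_neg hodd, if_pos this, map_add, map_sub,
        linearCombination_sg, hc, wNeg_row_succ_self har]
      split_ifs <;> omega
  · have hc : Finsupp.linearCombination ℤ (wNeg k (rho k r))
        (if -n ≠ k - 2 then sg (-n + 2) (k - 2) else 0) = if r < n then -1 else 0 := by
      split_ifs with h1 h2 h2
      · rw [linearCombination_sg, wNeg_col_pred hr har hn h, if_pos h2]
      · rw [linearCombination_sg, wNeg_col_pred hr har hn h, if_neg h2]
      · omega
      · simp
    rw [e, if_neg h'.ne, upNeg, if_neg h'.not_gt, if_neg h'.ne, map_add, map_sub,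
      linearCombination_sg, hc, wNeg_col har hn h, add_zero]
    split_ifs <;> omega

theorem IsTheta.upNeg (hk : Odd k) (hk0 : 0 < k) (hm : IsTheta m)
    (hn : IsFirstMax (-k + 2) (fun r => Aneg k m (rho k r)) n) :
    IsTheta (upNeg k m (rho k n)) := by
  obtain ⟨ho, han, hmax⟩ := hn
  have hpred (h : -k + 2 ≤ n - 2) : Aneg k m (rho k (n - 2)) < Aneg k m (rho k n) :=
    (hmax (n - 2) (ho.sub_even (by decide)) h).2 (by omega)
  have ho' := Int.odd_iff.1 ho
  have hk' := Int.odd_iff.1 hk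
  have hkn : Odd (-k) := hk.neg
  have hkn2 : Odd (-k + 2) := hkn.add_even (by decide)
  rcases rho_cases han with ⟨h, e⟩ | ⟨rfl, e⟩ | ⟨h, e, h', h''⟩
  · rw [e, _root_.upNeg, if_pos h]
    refine IsTheta.add_sg (hm.sub_sg ?_) hkn ho (by omega) (by omega)
    have hp := hpred (by omega)
    rw [rho_of_le (by omega), e] at hp
    rcases (show n = k + 2 ∨ k < n - 2 by omega) with rfl | h2
    · have h1 := Aneg_self (m := m) hk
      have h3 := hm.nonneg (-k, k)
      rw [add_sub_cancel_right] at hp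
      split_ifs at h1 <;> omega
    · have h1 := Aneg_row_succ (m := m) (ho.sub_even (by decide)) h2
      have h3 := hm.nonneg (-k, n - 2)
      rw [sub_add_cancel] at h1
      omega
  · rw [e, _root_.upNeg, if_neg (lt_irrefl n), if_pos rfl]
    split_ifs with hodd h1
    · refine IsTheta.add_sg (hm.sub_sg ?_) hkn ho (by omega) (by omega)
      have := hm.nonneg (-n + 2, n)
      rw [Int.odd_iff] at hodd
      omega
    · refine IsTheta.add_sg (hm.sub_sg ?_) hkn2 ho (by omega) (by omega)
      have hp := hpred (by omega)
      rw [rho_of_lt (by omega), e, show -(n - 2) = -n + 2 by ring] at hp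
      have h2 := Aneg_corner (m := m) hk (by omega)
      rw [if_neg hodd] at h2
      have h3 := hm.nonneg (-n + 4, n)
      omega
    · rw [sub_zero]
      exact hm.add_sg hkn2 ho (by omega) (by omega)
  · rw [e, _root_.upNeg, if_neg h'.not_gt, if_neg h'.ne]
    have hon : Odd (-n + 2) := ho.neg.add_even (by decide)
    split_ifs with h1
    · refine IsTheta.add_sg (hm.sub_sg ?_) hon hk (by omega) (by omega)
      have hp := hpred (by omega)
      rw [rho_of_lt (by omega), e, show -(n - 2) = -n + 2 by ring] at hp
      have h2 := Aneg_col_succ (m := m) ho.neg (by omega) (by omega : -n + 2 < k)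
      have h3 := hm.nonneg (-n + 4, k)
      omega
    · rw [sub_zero]
      exact hm.add_sg hon hk (by omega) (by omega)

theorem IsTheta.downNeg (hk : Odd k) (hk0 : 0 < k) (hm : IsTheta m)
    (hn : IsLastMax (-k + 2) (fun r => Aneg k m (rho k r)) n) :
    IsTheta (downNeg k m (rho k n)) := by
  obtain ⟨ho, han, hmax⟩ := hn
  have hsucc : Aneg k m (rho k (n + 2)) < Aneg k m (rho k n) :=
    (hmax (n + 2) (ho.add_even (by decide)) (by omega)).2 (by omega)
  have ho' := Int.odd_iff.1 ho
  have hk' := Int.odd_iff.1 hk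
  have hkn : Odd (-k) := hk.neg
  have hkn2 : Odd (-k + 2) := hkn.add_even (by decide)
  rcases rho_cases han with ⟨h, e⟩ | ⟨rfl, e⟩ | ⟨h, e, h', h''⟩
  · rw [e, _root_.downNeg, if_pos h]
    refine IsTheta.add_sg (hm.sub_sg ?_) hkn2 ho (by omega) (by omega)
    rw [rho_of_le (by omega), e] at hsucc
    have h1 := Aneg_row_succ (m := m) ho h
    have h3 := hm.nonneg (-k + 2, n + 2)
    omega
  · rw [e, _root_.downNeg, if_neg (lt_irrefl n), if_pos rfl]
    rw [rho_of_le (by omega), e] at hsucc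
    split_ifs with hodd h1
    · refine IsTheta.add_sg (hm.sub_sg ?_) hkn2 (ho.sub_even (by decide)) (by omega) (by omega)
      have := hm.nonneg (-n + 2, n)
      rw [Int.odd_iff] at hodd
      omega
    · rw [add_zero]
      refine hm.sub_sg ?_
      have := hm.nonneg (-n + 2, n)
      rw [Int.odd_iff] at hodd
      omega
    · refine IsTheta.add_sg (hm.sub_sg ?_) hkn2 ho (by omega) (by omega)
      have h1 := Aneg_self (m := m) hk
      have h3 := hm.nonneg (-n + 2, n + 2)
      rw [if_neg hodd] at h1
      omega
  · rw [e, _root_.downNeg, if_neg h'.not_gt, if_neg h'.ne]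
    have hon : Odd (-n + 2) := ho.neg.add_even (by decide)
    have hpos : 0 < m (-n + 2, k) := by
      rw [e] at hsucc
      rcases (show n = k - 2 ∨ n + 2 < k by omega) with rfl | h2
      · rw [sub_add_cancel, rho_of_le le_rfl, show -(k - 2) = -k + 2 by ring] at hsucc
        rw [show -(k - 2) + 2 = -k + 4 by ring]
        have h1 := Aneg_corner (m := m) hk (by omega)
        have h3 := hm.nonneg (-k + 2, k - 2)
        split_ifs at h1 <;> omega
      · rw [rho_of_lt h2] at hsucc
        have h1 := Aneg_col_succ (m := m) (ho.add_even (by decide : Even (2 : ℤ))).neg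
          (by omega) (by omega : -(n + 2) + 2 < k)
        rw [show -(n + 2) + 2 = -n by ring, show -(n + 2) + 4 = -n + 2 by ring] at h1
        have h3 := hm.nonneg (-n, k - 2)
        omega
    split_ifs with h1
    · exact IsTheta.add_sg (hm.sub_sg hpos) hon (hk.sub_even (by decide)) (by omega) (by omega)
    · rw [add_zero]
      exact hm.sub_sg hpos

theorem image_rho (hk : Odd k) (hk0 : 0 < k) (Q : ℤ → Prop) :
    rho k '' {j | Odd j ∧ -k + 2 ≤ j ∧ Q j} = {r | Odd r ∧ -k + 2 ≤ r ∧ Q (rho k r)} := by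
  ext r
  constructor
  · rintro ⟨j, ⟨hj, haj, hQ⟩, rfl⟩
    obtain ⟨h1, h2, h3⟩ := rho_mem hk hk0 hj haj
    exact ⟨h1, h2, by rwa [h3]⟩
  · rintro ⟨hr, har, hQ⟩
    obtain ⟨h1, h2, h3⟩ := rho_mem hk hk0 hr har
    exact ⟨rho k r, ⟨h1, h2, hQ⟩, h3⟩

theorem epsNeg_eq_sSup (hk : Odd k) (hk0 : 0 < k) (m : MS) :
    epsNeg k m = sSup ((fun r => Aneg k m (rho k r)) '' {r | Odd r ∧ -k + 2 ≤ r}) := by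
  have h := image_rho hk hk0 fun _ => True
  simp only [and_true] at h
  rw [← h, Set.image_image, epsNeg]
  congr 1
  refine Set.image_congr fun r hr => ?_
  rw [(rho_mem hk hk0 hr.1 hr.2).2.2]

theorem crystal_neg (hk : Odd k) (hk0 : 0 < k) :
    (∀ m, IsTheta m → IsTheta (FtilNeg k m)) ∧
    (∀ m m', IsTheta m → EtilNeg k m = some m' → IsTheta m') ∧
    (∀ m m', IsTheta m → EtilNeg k m = some m' → FtilNeg k m' = m) ∧
    (∀ m, IsTheta m → EtilNeg k (FtilNeg k m) = some m) ∧
    (∀ m, IsTheta m → 0 ≤ epsNeg k m ∧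
      IsGreatest {i : ℕ | (fun o => Option.bind o (EtilNeg k))^[i] (some m) ≠ none}
        (epsNeg k m).toNat) := by
  refine crystal_of_signature (B := fun m r => Aneg k m (rho k r))
    (up := fun m n => upNeg k m (rho k n)) (down := fun m n => downNeg k m (rho k n)) (-k + 2)
    (fun m => ?_) (fun m n hm hn => ⟨hm.upNeg hk hk0 hn, isRaise_Aneg hk hk0 hn.1 hn.2.1,
      downNeg_upNeg (rho_mem hk hk0 hn.1 hn.2.1).2.1⟩)
    (fun m n hm hn => ⟨hm.downNeg hk hk0 hn, ?_,
      upNeg_downNeg (rho_mem hk hk0 hn.1 hn.2.1).2.1⟩)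
    (fun m n hn => ?_) (fun m n hn => ?_) (fun m hm => if_pos hm) (fun m n hn he hne => ?_)
  · obtain ⟨N, hN⟩ := Apos_eventually_zero (-k) m
    refine ⟨max N (k + 1), fun r hr => ?_⟩
    have hkr : k < r := by have := le_max_right N (k + 1); omega
    rw [rho_of_le hkr.le, Aneg_eq_Apos hkr, hN r (le_trans (le_max_left _ _) hr)]
  · have := isRaise_Aneg (m := downNeg k m (rho k n)) hk hk0 hn.1 hn.2.1
    rwa [upNeg_downNeg (rho_mem hk hk0 hn.1 hn.2.1).2.1] at this
  · rw [epsNeg_eq_sSup hk hk0, hn.sSup_eq]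
  · have : nfIdx k m = rho k n := by
      rw [nfIdx, image_rho hk hk0 fun j => Aneg k m j = epsNeg k m, epsNeg_eq_sSup hk hk0,
        hn.sSup_eq, hn.sInf_eq, rho]
    rw [FtilNeg, this, upNeg]
  · have : neIdx k m = rho k n := by
      rw [neIdx, image_rho hk hk0 fun j => Aneg k m j = epsNeg k m, he, hn.sSup_eq, rho]
    rw [EtilNeg, if_neg hne, this, downNeg]

end Negative

/-- Theorem 4.6 of Enomoto–Kashiwara: with the operators `Ẽ_k`, `F̃_k`, `ε_k`
(`k ∈ I = ℤ_odd`), the set `M_θ` of θ-restricted multisegments is a crystal. -/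
theorem crystal_structure (k : ℤ) (hk : Odd k) :
    (∀ m : MS, IsTheta m → IsTheta (Ftil k m)) ∧
    (∀ m m' : MS, IsTheta m → Etil k m = some m' → IsTheta m') ∧
    (∀ m m' : MS, IsTheta m → Etil k m = some m' → Ftil k m' = m) ∧
    (∀ m : MS, IsTheta m → Etil k (Ftil k m) = some m) ∧
    (∀ m : MS, IsTheta m → 0 ≤ eps k m ∧
      IsGreatest {n : ℕ | EtilIter k n m ≠ none} (eps k m).toNat) := by
  by_cases h : 0 < k
  · have hE : Etil k = EtilPos k := funext fun m => if_pos h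
    simpa only [Ftil, hE, eps, EtilIter, if_pos h] using crystal_pos hk h
  · have h0 : 0 < -k := by
      rw [Int.odd_iff] at hk
      omega
    have hE : Etil k = EtilNeg (-k) := funext fun m => if_neg h
    simpa only [Ftil, hE, eps, EtilIter, if_neg h] using crystal_neg hk.neg h0

end
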